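/- Let n ≥ 2 and let e_1, …, e_n denote the standard basis vectors of ℤ^n. The set A = {0, e_1, −e_1, e_2, −e_2, …, e_n, −e_n} ⊆ ℤ^n is a finite symmetric set of relatively prime lattice points containing 0, yet there is no compact set K ⊆ ℝ^n with K + ℤ^n = ℝ^n such that A = (K − K) ∩ ℤ^n. Hence not every finite symmetric set of relatively prime lattice points containing 0 is of the form (K − K) ∩ ℤ^n for an N-set K. -/

import Mathlib

open Pointwise

/-- Lattice points on the coordinate axes within distance one of the origin have at most one
nonzero coordinate. -/
theorem mul_apply_eq_zero_of_mem_cross {n : ℕ} {i j : Fin n} (hij : i ≠ j) {z : Fin n → ℤ}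
    (hz : z ∈ ({0} ∪ ⋃ l : Fin n, {Pi.single l 1, -Pi.single l 1} : Set (Fin n → ℤ))) :
    z i * z j = 0 := by
  simp only [Set.mem_union, Set.mem_singleton_iff, Set.mem_iUnion, Set.mem_insert_iff] at hz
  rcases hz with rfl | ⟨l, rfl | rfl⟩
  · simp
  all_goals
    by_cases h : i = l
    · subst h
      simp [Pi.single_eq_of_ne hij.symm]
    · simp [Pi.single_eq_of_ne h]

/-- A discrete Green formula: a grid map to the plane that winds once around each of the two unit
translations has a cell on which the two coordinates vary along consecutive edges. -/
theorem false_of_grid_of_cells_degenerate {N : ℕ} (a b : ℕ → ℕ → ℤ)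
    (haN : ∀ j, a N j = a 0 j + 1) (hbN : ∀ j, b N j = b 0 j)
    (haN' : ∀ i, a i N = a i 0) (hbN' : ∀ i, b i N = b i 0 + 1)
    (h₁ : ∀ i j, (a (i + 1) j - a i j) * (b (i + 1) (j + 1) - b (i + 1) j) = 0)
    (h₂ : ∀ i j, (a i (j + 1) - a i j) * (b (i + 1) (j + 1) - b i (j + 1)) = 0) : False := by
  have cell : ∀ i j, a (i + 1) j * (b (i + 1) (j + 1) - b (i + 1) j) -
      a i j * (b i (j + 1) - b i j) =
      a i (j + 1) * (b (i + 1) (j + 1) - b i (j + 1)) - a i j * (b (i + 1) j - b i j) := by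
    intro i j
    linear_combination h₁ i j - h₂ i j
  have key : ∑ j ∈ Finset.range N, ∑ i ∈ Finset.range N,
      (a (i + 1) j * (b (i + 1) (j + 1) - b (i + 1) j) - a i j * (b i (j + 1) - b i j)) =
      ∑ i ∈ Finset.range N, ∑ j ∈ Finset.range N,
      (a i (j + 1) * (b (i + 1) (j + 1) - b i (j + 1)) - a i j * (b (i + 1) j - b i j)) := by
    rw [Finset.sum_comm]
    exact Finset.sum_congr rfl fun i _ => Finset.sum_congr rfl fun j _ => cell i j
  have left : ∀ j, ∑ i ∈ Finset.range N,
      (a (i + 1) j * (b (i + 1) (j + 1) - b (i + 1) j) - a i j * (b i (j + 1) - b i j)) =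
      b 0 (j + 1) - b 0 j := by
    intro j
    rw [Finset.sum_range_sub (fun i => a i j * (b i (j + 1) - b i j)), haN, hbN, hbN]
    ring
  have right : ∀ i, ∑ j ∈ Finset.range N,
      (a i (j + 1) * (b (i + 1) (j + 1) - b i (j + 1)) - a i j * (b (i + 1) j - b i j)) = 0 := by
    intro i
    rw [Finset.sum_range_sub (fun j => a i j * (b (i + 1) j - b i j)), haN', hbN', hbN']
    ring
  simp only [left, right, Finset.sum_const_zero] at key
  rw [Finset.sum_range_sub (b 0), hbN'] at key
  omega

/-- A lattice point sufficiently close to a compact set belongs to it. -/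
theorem IsCompact.exists_pos_forall_intCast_mem {n : ℕ} {D : Set (Fin n → ℝ)} (hD : IsCompact D) :
    ∃ ε > 0, ∀ d ∈ D, ∀ z : Fin n → ℤ, dist d (fun i => (z i : ℝ)) < ε →
      (fun i => (z i : ℝ)) ∈ D := by
  have hemb : Topology.IsClosedEmbedding (fun (z : Fin n → ℤ) i => (z i : ℝ)) :=
    Topology.IsClosedEmbedding.piMap fun _ => Int.isClosedEmbedding_coe_real
  have hclosed : IsClosed ((fun (z : Fin n → ℤ) i => (z i : ℝ)) ''
      {z | (fun i => (z i : ℝ)) ∉ D}) := hemb.isClosedMap _ (isClosed_discrete _)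
  have hdisj : Disjoint D ((fun (z : Fin n → ℤ) i => (z i : ℝ)) ''
      {z | (fun i => (z i : ℝ)) ∉ D}) := by
    rw [Set.disjoint_left]
    rintro _ hx ⟨z, hz, rfl⟩
    exact hz hx
  obtain ⟨ε, hε, h⟩ := hdisj.exists_thickenings hD hclosed
  refine ⟨ε, hε, fun d hd z hz => ?_⟩
  by_contra hzD
  exact Set.disjoint_left.1 h (Metric.self_subset_thickening hε D hd)
    (Metric.mem_thickening_iff.2 ⟨_, ⟨z, hzD, rfl⟩, hz⟩)

/-- A set meeting every class modulo the lattice admits a lattice-equivariant choice of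
translations carrying each point into it. -/
theorem exists_equivariant_translation {n : ℕ} {K : Set (Fin n → ℝ)}
    (hK : ∀ x : Fin n → ℝ, ∃ y ∈ K, ∃ z : Fin n → ℤ, x = y + fun i => (z i : ℝ)) :
    ∃ c : (Fin n → ℝ) → Fin n → ℤ, (∀ x, (x - fun i => (c x i : ℝ)) ∈ K) ∧
      ∀ (x : Fin n → ℝ) (z : Fin n → ℤ), c (x + fun i => (z i : ℝ)) = c x + z := by
  choose y hy t ht using hK
  refine ⟨fun x => t (fun i => Int.fract (x i)) + fun i => ⌊x i⌋, fun x => ?_, fun x z => ?_⟩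
  · convert hy (fun i => Int.fract (x i)) using 1
    funext i
    have := congrFun (ht fun i => Int.fract (x i)) i
    simp only [Pi.add_apply, Pi.sub_apply, Int.cast_add] at this ⊢
    linarith [Int.floor_add_fract (x i)]
  · funext i
    simp [add_assoc]

/-- No compact set covering the torus has all its lattice differences in the cross. -/
theorem not_forall_mem_cross {n : ℕ} {i₀ i₁ : Fin n} (hne : i₀ ≠ i₁) {K : Set (Fin n → ℝ)}
    (hK : IsCompact K)
    (hcov : ∀ x : Fin n → ℝ, ∃ y ∈ K, ∃ z : Fin n → ℤ, x = y + fun i => (z i : ℝ))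
    (hdiff : ∀ z : Fin n → ℤ, (fun i => (z i : ℝ)) ∈ K - K → z i₀ * z i₁ = 0) : False := by
  obtain ⟨c, hcK, hcz⟩ := exists_equivariant_translation hcov
  have hKK : IsCompact (K - K) := by
    simpa only [Set.sub_image_prod] using (hK.prod hK).image continuous_sub
  obtain ⟨ε, hε, hclose⟩ := hKK.exists_pos_forall_intCast_mem
  have hc : ∀ x y, dist x y < ε → (c y i₀ - c x i₀) * (c y i₁ - c x i₁) = 0 := by
    intro x y hxy
    refine hdiff (c y - c x) (hclose _ (Set.sub_mem_sub (hcK x) (hcK y)) _ ?_)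
    convert hxy using 1
    rw [dist_eq_norm, dist_eq_norm]
    congr 1
    funext i
    simp only [Pi.sub_apply, Int.cast_sub]
    ring
  obtain ⟨N, hN⟩ := exists_nat_one_div_lt hε
  set p : ℕ → ℕ → Fin n → ℝ := fun i j =>
    Pi.single i₀ ((i : ℝ) / (N + 1)) + Pi.single i₁ ((j : ℝ) / (N + 1)) with hp
  have hN0 : (N : ℝ) + 1 ≠ 0 := by positivity
  have hpx : ∀ j, p (N + 1) j = p 0 j + fun i => ((Pi.single i₀ 1 : Fin n → ℤ) i : ℝ) := by
    intro j
    funext l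
    by_cases h : l = i₀ <;> simp [hp, Pi.single_apply, h, hN0, hne]
  have hpy : ∀ i, p i (N + 1) = p i 0 + fun l => ((Pi.single i₁ 1 : Fin n → ℤ) l : ℝ) := by
    intro j
    funext l
    by_cases h : l = i₁ <;> simp [hp, Pi.single_apply, h, hN0]
  have hnear : ∀ i j i' j' : ℕ, |(i : ℝ) - i'| ≤ 1 → |(j : ℝ) - j'| ≤ 1 →
      dist (p i j) (p i' j') < ε := by
    intro i j i' j' hi hj
    refine lt_of_le_of_lt ((dist_pi_le_iff (by positivity)).2 fun l => ?_) hN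
    have hscale : ∀ s t : ℝ, |s - t| ≤ 1 → |s / (N + 1) - t / (N + 1)| ≤ 1 / ((N : ℝ) + 1) := by
      intro s t hst
      rw [← sub_div, abs_div, abs_of_pos (show (0 : ℝ) < N + 1 by positivity)]
      gcongr
    rw [Real.dist_eq]
    by_cases h₀ : l = i₀
    · subst h₀
      simpa [hp, Pi.single_eq_of_ne hne] using hscale _ _ hi
    · by_cases h₁ : l = i₁
      · subst h₁
        simpa [hp, Pi.single_eq_of_ne h₀] using hscale _ _ hj
      · simp [hp, Pi.single_eq_of_ne h₀, Pi.single_eq_of_ne h₁]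
        positivity
  have hcell : ∀ u v w : Fin n → ℝ, dist u v < ε → dist v w < ε → dist u w < ε →
      (c v i₀ - c u i₀) * (c w i₁ - c v i₁) = 0 := by
    intro u v w huv hvw huw
    have h₁ := hc u v huv
    have h₂ := hc v w hvw
    have h₃ := hc u w huw
    by_contra h
    have hb := (mul_eq_zero.1 h₁).resolve_left (left_ne_zero_of_mul h)
    have ha := (mul_eq_zero.1 h₂).resolve_right (right_ne_zero_of_mul h)
    rw [sub_eq_zero.1 ha, ← sub_eq_zero.1 hb] at h₃
    exact h h₃
  refine false_of_grid_of_cells_degenerate (N := N + 1)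
    (fun i j => c (p i j) i₀) (fun i j => c (p i j) i₁) ?_ ?_ ?_ ?_ ?_ ?_
  · intro j
    simp [hpx, hcz]
  · intro j
    simp [hpx, hcz, Pi.single_eq_of_ne hne.symm]
  · intro i
    simp [hpy, hcz, Pi.single_eq_of_ne hne]
  · intro i
    simp [hpy, hcz]
  · intro i j
    apply hcell <;> apply hnear <;> simp
  · intro i j
    apply hcell <;> apply hnear <;> simp

/-- For n ≥ 2, the set `A = {0, ±e₁, …, ±eₙ} ⊆ ℤⁿ` is a finite symmetric
set of relatively prime lattice points containing 0, yet is not of the form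
`(K - K) ∩ ℤⁿ` for any compact `K ⊆ ℝⁿ` with `K + ℤⁿ = ℝⁿ`. -/
theorem standard_cross_not_difference_set (n : ℕ) (hn : 2 ≤ n) :
    (({0} ∪ ⋃ l : Fin n, {Pi.single l 1, -Pi.single l 1} : Set (Fin n → ℤ)).Finite ∧
      ({0} ∪ ⋃ l : Fin n, {Pi.single l 1, -Pi.single l 1} : Set (Fin n → ℤ)) =
        -({0} ∪ ⋃ l : Fin n, {Pi.single l 1, -Pi.single l 1} : Set (Fin n → ℤ)) ∧
      (0 : Fin n → ℤ) ∈
        ({0} ∪ ⋃ l : Fin n, {Pi.single l 1, -Pi.single l 1} : Set (Fin n → ℤ)) ∧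
      AddSubgroup.closure
        ({0} ∪ ⋃ l : Fin n, {Pi.single l 1, -Pi.single l 1} : Set (Fin n → ℤ)) = ⊤) ∧
    ¬ ∃ K : Set (Fin n → ℝ), IsCompact K ∧
      (∀ x : Fin n → ℝ, ∃ y ∈ K, ∃ z : Fin n → ℤ, x = y + fun i => (z i : ℝ)) ∧
      (∀ z : Fin n → ℤ,
        z ∈ ({0} ∪ ⋃ l : Fin n, {Pi.single l 1, -Pi.single l 1} : Set (Fin n → ℤ)) ↔
          (fun i => (z i : ℝ)) ∈ K - K) := by
  refine ⟨⟨?_, ?_, ?_, ?_⟩, ?_⟩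
  · exact (Set.finite_singleton _).union (Set.finite_iUnion fun l => Set.toFinite _)
  · ext z
    simp only [Set.mem_neg, Set.mem_union, Set.mem_singleton_iff, Set.mem_iUnion,
      Set.mem_insert_iff, neg_eq_zero, neg_inj]
    refine or_congr_right (exists_congr fun l => ?_)
    rw [neg_eq_iff_eq_neg, or_comm]
  · simp
  · rw [eq_top_iff]
    intro z _
    rw [← Finset.univ_sum_single z]
    refine AddSubgroup.sum_mem _ fun l _ => ?_
    have hl : (Pi.single l (z l) : Fin n → ℤ) = z l • Pi.single l 1 := by
      rw [← Pi.single_smul]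
      simp
    rw [hl]
    refine AddSubgroup.zsmul_mem _ (AddSubgroup.subset_closure (Set.mem_union_right _ ?_)) _
    exact Set.mem_iUnion.2 ⟨l, Or.inl rfl⟩
  · rintro ⟨K, hK, hcov, hdiff⟩
    have hne : (⟨0, by omega⟩ : Fin n) ≠ ⟨1, by omega⟩ := by simp
    exact not_forall_mem_cross hne hK hcov fun z hz =>
      mul_apply_eq_zero_of_mem_cross hne ((hdiff z).2 hz)
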